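/- There exists a vector v ∈ ℤ^7 with v_0 + ... + v_6 = 0 such that v·i > 0 for every i ∈ 𝕀 with (8,5,3,2,-4,-4,-10)·i ≥ 0. In other words, the set 𝕀(r_23)_{≥0} is unstable with respect to the maximal torus: it is contained in 𝕀(v)_{>0} for some one-parameter subgroup v. -/

import Mathlib

/- The witness is `6 • r + w` with `r = (8, 5, 3, 2, -4, -4, -10)` and `w = (1, 1, -6, 1, 1, 1, 1)`:
no exponent `i` with `r · i = 0` involves the third coordinate, so `w · i = 3` there, while
`w` is dominated by `6 • r` where `r · i > 0`. -/
theorem I_r23_unstable :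
    ∃ v : Fin 7 → ℤ, ∑ k, v k = 0 ∧
      ∀ i : Fin 7 → ℕ, ∑ k, i k = 3 →
        0 ≤ ∑ k, (![8, 5, 3, 2, -4, -4, -10] : Fin 7 → ℤ) k * (i k : ℤ) →
        0 < ∑ k, v k * (i k : ℤ) := by
  refine ⟨![49, 31, 12, 13, -23, -23, -59], by decide, fun i hsum hr => ?_⟩
  simp [Fin.sum_univ_succ] at hsum hr ⊢
  have hc : i 2 ≤ 3 := by omega
  interval_cases i 2 <;> omega
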